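/- Let w > 0, σ > 0, assume the pair (A, B) is controllable and the prediction horizon N is greater than or equal to the controllability index of (A, B), and assume D ∩ C_σ is nonempty. Let the reference parameters evolve as r_x(t) = (T̂_w^{n_x})^t r_x(0), r_u(t) = (T̂_w^{n_u})^t r_u(0), and let (x̊(0), ů(0)) be the unique minimizer of V_h with reference (r_x(0), r_u(0)) over D ∩ C_σ; define the optimal artificial harmonic reference trajectory x̊(t) := x̊_e(0) + x̊_s(0)·sin(w t) + x̊_c(0)·cos(w t). Let x(0) belong to the feasibility region of HMPC and define the closed-loop trajectory by x(t+1) = A x(t) + B u(t), where u(t) = u^0 for some optimal solution of the HMPC problem at state x(t) with reference (r_x(t), r_u(t)). Then: (i) x(t) belongs to the feasibility region for all t ∈ ℕ; (ii) y̲ ≤ E x(t) + F u(t) ≤ ȳ componentwise for all t ∈ ℕ; and (iii) lim_{t→∞} ‖x(t) − x̊(t)‖ = 0. Moreover, the closed-loop trajectory is Lyapunov stable with respect to x̊(t): for every ε > 0 there exists δ > 0 such that if x(0) is feasible and ‖x(0) − x̊(0)‖ ≤ δ, then ‖x(t) − x̊(t)‖ ≤ ε for all t ∈ ℕ. -/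

import Mathlib

open Matrix Filter

/-- Vectors in `ℝ^n`. -/
abbrev RVec (n : ℕ) := Fin n → ℝ

/-- A parameter triple `(v_e, v_s, v_c) ∈ (ℝ^m)³` of a harmonic signal. -/
abbrev HTriple (n : ℕ) := RVec n × RVec n × RVec n

/-- A parameter pair `((x̂_e, x̂_s, x̂_c), (û_e, û_s, û_c))`. -/
abbrev HParams (nx nu : ℕ) := HTriple nx × HTriple nu

/-- Value at (relative) time `k` of the harmonic signal parameterized by the triple `v`
with frequency `w`: `v_e + v_s sin(w k) + v_c cos(w k)`. -/
noncomputable def hSeq {m : ℕ} (w : ℝ) (v : HTriple m) (k : ℕ) : RVec m :=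
  v.1 + Real.sin (w * (k : ℝ)) • v.2.1 + Real.cos (w * (k : ℝ)) • v.2.2

/-- The transform `T̂_w^m` acting on parameter triples: the identity acts on `v_e` and the
rotation `T_w^m = [[cos w · I, -sin w · I], [sin w · I, cos w · I]]` acts on `(v_s, v_c)`. -/
noncomputable def hatT {m : ℕ} (w : ℝ) (v : HTriple m) : HTriple m :=
  (v.1, Real.cos w • v.2.1 - Real.sin w • v.2.2, Real.sin w • v.2.1 + Real.cos w • v.2.2)

/-- Membership in the set `D` (harmonic parameters consistent with the dynamics `x⁺ = Ax + Bu`). -/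
def inD {nx nu : ℕ} (A : Matrix (Fin nx) (Fin nx) ℝ) (B : Matrix (Fin nx) (Fin nu) ℝ)
    (w : ℝ) (p : HParams nx nu) : Prop :=
  p.1.1 = A.mulVec p.1.1 + B.mulVec p.2.1 ∧
  Real.cos w • p.1.2.1 - Real.sin w • p.1.2.2 = A.mulVec p.1.2.1 + B.mulVec p.2.2.1 ∧
  Real.sin w • p.1.2.1 + Real.cos w • p.1.2.2 = A.mulVec p.1.2.2 + B.mulVec p.2.2.2

/-- Membership in the set `C_σ` (second-order-cone conditions guaranteeing constraint
satisfaction of the harmonic signal). -/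
def inC {nx nu ny : ℕ} (E : Matrix (Fin ny) (Fin nx) ℝ) (F : Matrix (Fin ny) (Fin nu) ℝ)
    (ylo yhi : RVec ny) (σ : ℝ) (p : HParams nx nu) : Prop :=
  ∀ i : Fin ny,
    Real.sqrt ((E.mulVec p.1.2.1 + F.mulVec p.2.2.1) i ^ 2
        + (E.mulVec p.1.2.2 + F.mulVec p.2.2.2) i ^ 2)
      ≤ yhi i - σ - (E.mulVec p.1.1 + F.mulVec p.2.1) i ∧
    Real.sqrt ((E.mulVec p.1.2.1 + F.mulVec p.2.2.1) i ^ 2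
        + (E.mulVec p.1.2.2 + F.mulVec p.2.2.2) i ^ 2)
      ≤ (E.mulVec p.1.1 + F.mulVec p.2.1) i - ylo i - σ

/-- The set `D ∩ C_σ` of admissible harmonic parameters. -/
def paramSet {nx nu ny : ℕ} (A : Matrix (Fin nx) (Fin nx) ℝ) (B : Matrix (Fin nx) (Fin nu) ℝ)
    (E : Matrix (Fin ny) (Fin nx) ℝ) (F : Matrix (Fin ny) (Fin nu) ℝ)
    (ylo yhi : RVec ny) (w σ : ℝ) : Set (HParams nx nu) :=
  {p | inD A B w p ∧ inC E F ylo yhi σ p}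

/-- The quadratic form `‖v‖²_M = vᵀ M v`. -/
def quadForm {n : ℕ} (M : Matrix (Fin n) (Fin n) ℝ) (v : RVec n) : ℝ :=
  v ⬝ᵥ M.mulVec v

/-- The offset cost `V_h` with reference parameters `r` evaluated at parameters `p`. -/
def Vh {nx nu : ℕ} (Te Th : Matrix (Fin nx) (Fin nx) ℝ) (Se Sh : Matrix (Fin nu) (Fin nu) ℝ)
    (r p : HParams nx nu) : ℝ :=
  quadForm Te (p.1.1 - r.1.1) + quadForm Th (p.1.2.1 - r.1.2.1)
    + quadForm Th (p.1.2.2 - r.1.2.2)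
    + quadForm Se (p.2.1 - r.2.1) + quadForm Sh (p.2.2.1 - r.2.2.1)
    + quadForm Sh (p.2.2.2 - r.2.2.2)

/-- `p` is the unique minimizer of `f` on `S`. -/
def IsUniqueMinOn {α : Type*} (f : α → ℝ) (S : Set α) (p : α) : Prop :=
  p ∈ S ∧ ∀ q ∈ S, q ≠ p → f p < f q

/-- `(xs, us, p)` is a feasible solution of the HMPC optimization problem for the state `x`. -/
def FeasSol {nx nu ny : ℕ} (A : Matrix (Fin nx) (Fin nx) ℝ) (B : Matrix (Fin nx) (Fin nu) ℝ)
    (E : Matrix (Fin ny) (Fin nx) ℝ) (F : Matrix (Fin ny) (Fin nu) ℝ)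
    (ylo yhi : RVec ny) (w σ : ℝ) (N : ℕ) (x : RVec nx)
    (xs : ℕ → RVec nx) (us : ℕ → RVec nu) (p : HParams nx nu) : Prop :=
  xs 0 = x ∧
  (∀ k < N, xs (k + 1) = A.mulVec (xs k) + B.mulVec (us k)) ∧
  (∀ k < N, ∀ i, ylo i ≤ (E.mulVec (xs k) + F.mulVec (us k)) i
      ∧ (E.mulVec (xs k) + F.mulVec (us k)) i ≤ yhi i) ∧
  xs N = hSeq w p.1 N ∧
  inD A B w p ∧ inC E F ylo yhi σ p

/-- `x` belongs to the feasibility region of the HMPC optimization problem. -/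
def Feasible {nx nu ny : ℕ} (A : Matrix (Fin nx) (Fin nx) ℝ) (B : Matrix (Fin nx) (Fin nu) ℝ)
    (E : Matrix (Fin ny) (Fin nx) ℝ) (F : Matrix (Fin ny) (Fin nu) ℝ)
    (ylo yhi : RVec ny) (w σ : ℝ) (N : ℕ) (x : RVec nx) : Prop :=
  ∃ xs us p, FeasSol A B E F ylo yhi w σ N x xs us p

/-- The HMPC cost `J` of a solution `(xs, us, p)` with reference parameters `r`. -/
noncomputable def Jcost {nx nu : ℕ} (Q Te Th : Matrix (Fin nx) (Fin nx) ℝ)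
    (R Se Sh : Matrix (Fin nu) (Fin nu) ℝ) (w : ℝ) (N : ℕ) (r : HParams nx nu)
    (xs : ℕ → RVec nx) (us : ℕ → RVec nu) (p : HParams nx nu) : ℝ :=
  (∑ k ∈ Finset.range N,
      (quadForm Q (xs k - hSeq w p.1 k) + quadForm R (us k - hSeq w p.2 k)))
    + Vh Te Th Se Sh r p

/-- `(xs, us, p)` is an optimal solution of the HMPC optimization problem for state `x` and
reference parameters `r`. -/
noncomputable def OptSol {nx nu ny : ℕ} (A : Matrix (Fin nx) (Fin nx) ℝ)
    (B : Matrix (Fin nx) (Fin nu) ℝ)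
    (E : Matrix (Fin ny) (Fin nx) ℝ) (F : Matrix (Fin ny) (Fin nu) ℝ)
    (ylo yhi : RVec ny) (Q Te Th : Matrix (Fin nx) (Fin nx) ℝ)
    (R Se Sh : Matrix (Fin nu) (Fin nu) ℝ) (w σ : ℝ) (N : ℕ) (r : HParams nx nu)
    (x : RVec nx) (xs : ℕ → RVec nx) (us : ℕ → RVec nu) (p : HParams nx nu) : Prop :=
  FeasSol A B E F ylo yhi w σ N x xs us p ∧
  ∀ xs' us' p', FeasSol A B E F ylo yhi w σ N x xs' us' p' →
    Jcost Q Te Th R Se Sh w N r xs us p ≤ Jcost Q Te Th R Se Sh w N r xs' us' p'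

/-- The optimal value `H*(x; r)` of the HMPC optimization problem. -/
noncomputable def Hstar {nx nu ny : ℕ} (A : Matrix (Fin nx) (Fin nx) ℝ)
    (B : Matrix (Fin nx) (Fin nu) ℝ)
    (E : Matrix (Fin ny) (Fin nx) ℝ) (F : Matrix (Fin ny) (Fin nu) ℝ)
    (ylo yhi : RVec ny) (Q Te Th : Matrix (Fin nx) (Fin nx) ℝ)
    (R Se Sh : Matrix (Fin nu) (Fin nu) ℝ) (w σ : ℝ) (N : ℕ) (r : HParams nx nu)
    (x : RVec nx) : ℝ :=
  sInf {J : ℝ | ∃ xs us p, FeasSol A B E F ylo yhi w σ N x xs us p ∧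
    J = Jcost Q Te Th R Se Sh w N r xs us p}

/-- The controllability matrix `[B, AB, …, A^{ν−1}B]` of the pair `(A, B)`. -/
def ctrbMat {nx nu : ℕ} (A : Matrix (Fin nx) (Fin nx) ℝ) (B : Matrix (Fin nx) (Fin nu) ℝ)
    (ν : ℕ) : Matrix (Fin nx) (Fin ν × Fin nu) ℝ :=
  Matrix.of fun i q => ((A ^ (q.1 : ℕ)) * B) i q.2

/-- Squared Euclidean norm of a vector. -/
def nsq {n : ℕ} (v : RVec n) : ℝ := ∑ i, v i ^ 2

/-- Squared Euclidean norm of a parameter pair. -/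
def pNsq {nx nu : ℕ} (p : HParams nx nu) : ℝ :=
  nsq p.1.1 + nsq p.1.2.1 + nsq p.1.2.2 + nsq p.2.1 + nsq p.2.2.1 + nsq p.2.2.2

/-- `f` is `μ`-strongly convex on the parameter space:
`f z − f y ≥ ⟨∇f(y), z − y⟩ + (μ/2)‖z − y‖²` for all `z, y`. -/
def StrConvVh {nx nu : ℕ} (μ : ℝ) (f : HParams nx nu → ℝ) : Prop :=
  ∀ z y : HParams nx nu, f z - f y ≥ (fderiv ℝ f y) (z - y) + μ / 2 * pNsq (z - y)

/-- The rotation matrix `T_w^m = [[cos w · I, −sin w · I], [sin w · I, cos w · I]] ∈ ℝ^{2m×2m}`. -/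
noncomputable def TwMat (m : ℕ) (w : ℝ) : Matrix (Fin m ⊕ Fin m) (Fin m ⊕ Fin m) ℝ :=
  Matrix.fromBlocks (Real.cos w • (1 : Matrix (Fin m) (Fin m) ℝ))
    (-(Real.sin w • (1 : Matrix (Fin m) (Fin m) ℝ)))
    (Real.sin w • (1 : Matrix (Fin m) (Fin m) ℝ))
    (Real.cos w • (1 : Matrix (Fin m) (Fin m) ℝ))

/-- The matrix `T̂_w^m = diag(I_m, T_w^m) ∈ ℝ^{3m×3m}`. -/
noncomputable def ThatMat (m : ℕ) (w : ℝ) :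
    Matrix (Fin m ⊕ (Fin m ⊕ Fin m)) (Fin m ⊕ (Fin m ⊕ Fin m)) ℝ :=
  Matrix.fromBlocks (1 : Matrix (Fin m) (Fin m) ℝ) 0 0 (TwMat m w)

section Homogeneous

variable {V : Type*} [NormedAddCommGroup V] [NormedSpace ℝ V] [FiniteDimensional ℝ V]

/-- A continuous function on a finite-dimensional space that is homogeneous of degree two is
bounded above by a multiple of the squared norm. -/
theorem exists_le_mul_norm_sq {f : V → ℝ} (hf : Continuous f)
    (hom : ∀ (c : ℝ) v, f (c • v) = c ^ 2 * f v) : ∃ C > 0, ∀ v, f v ≤ C * ‖v‖ ^ 2 := by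
  have : ProperSpace V := FiniteDimensional.proper ℝ V
  obtain ⟨C, hC⟩ := (isCompact_sphere (0 : V) 1).bddAbove_image hf.continuousOn
  refine ⟨max C 1, by positivity, fun v => ?_⟩
  rcases eq_or_ne v 0 with rfl | hv
  · have := hom 0 0
    simp_all
  · have hn : ‖v‖ ≠ 0 := norm_ne_zero_iff.2 hv
    have h := hC (Set.mem_image_of_mem f (show ‖v‖⁻¹ • v ∈ Metric.sphere (0 : V) 1 by
      simp [norm_smul, hn]))
    have hv' : f v = ‖v‖ ^ 2 * f (‖v‖⁻¹ • v) := by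
      rw [← hom, smul_inv_smul₀ hn]
    rw [hv', mul_comm]
    gcongr
    exact h.trans (le_max_left _ _)

/-- A continuous positive definite function on a finite-dimensional space that is homogeneous of
degree two is bounded below by a positive multiple of the squared norm. -/
theorem exists_mul_norm_sq_le {f : V → ℝ} (hf : Continuous f)
    (hom : ∀ (c : ℝ) v, f (c • v) = c ^ 2 * f v) (hpos : ∀ v, v ≠ 0 → 0 < f v) :
    ∃ μ > 0, ∀ v, μ * ‖v‖ ^ 2 ≤ f v := by
  have : ProperSpace V := FiniteDimensional.proper ℝ V
  have hzero : f 0 = 0 := by simpa using hom 0 0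
  rcases (Metric.sphere (0 : V) 1).eq_empty_or_nonempty with hS | hS
  · refine ⟨1, one_pos, fun v => ?_⟩
    rcases eq_or_ne v 0 with rfl | hv
    · simp [hzero]
    · have hn : ‖v‖ ≠ 0 := norm_ne_zero_iff.2 hv
      have : ‖v‖⁻¹ • v ∈ Metric.sphere (0 : V) 1 := by simp [norm_smul, hn]
      simp [hS] at this
  · obtain ⟨v₀, hv₀, hmin⟩ := (isCompact_sphere (0 : V) 1).exists_isMinOn hS hf.continuousOn
    refine ⟨f v₀, hpos _ (ne_zero_of_mem_unit_sphere ⟨v₀, hv₀⟩), fun v => ?_⟩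
    rcases eq_or_ne v 0 with rfl | hv
    · simp [hzero]
    · have hn : ‖v‖ ≠ 0 := norm_ne_zero_iff.2 hv
      have h : f v₀ ≤ f (‖v‖⁻¹ • v) := hmin (by simp [norm_smul, hn])
      have hv' : f v = ‖v‖ ^ 2 * f (‖v‖⁻¹ • v) := by
        rw [← hom, smul_inv_smul₀ hn]
      rw [hv', mul_comm]
      gcongr

end Homogeneous

section QuadForm

variable {n nx nu : ℕ}

theorem continuous_quadForm (M : Matrix (Fin n) (Fin n) ℝ) : Continuous (quadForm M) := by
  unfold quadForm
  fun_prop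

theorem quadForm_smul (M : Matrix (Fin n) (Fin n) ℝ) (c : ℝ) (v : RVec n) :
    quadForm M (c • v) = c ^ 2 * quadForm M v := by
  simp only [quadForm, mulVec_smul, dotProduct_smul, smul_dotProduct, smul_eq_mul]
  ring

theorem quadForm_pos {M : Matrix (Fin n) (Fin n) ℝ} (hM : M.PosDef) {v : RVec n} (hv : v ≠ 0) :
    0 < quadForm M v := by
  simpa [quadForm] using hM.dotProduct_mulVec_pos hv

theorem quadForm_nonneg {M : Matrix (Fin n) (Fin n) ℝ} (hM : M.PosDef) (v : RVec n) :
    0 ≤ quadForm M v := by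
  simpa [quadForm] using hM.posSemidef.dotProduct_mulVec_nonneg v

theorem quadForm_lin_comb (M : Matrix (Fin n) (Fin n) ℝ) (a b : ℝ) (v w : RVec n) :
    quadForm M (a • v + b • w) = a ^ 2 * quadForm M v
      + a * b * (v ⬝ᵥ M.mulVec w + w ⬝ᵥ M.mulVec v) + b ^ 2 * quadForm M w := by
  simp only [quadForm, mulVec_add, mulVec_smul, dotProduct_add, add_dotProduct, dotProduct_smul,
    smul_dotProduct, smul_eq_mul]
  ring

theorem quadForm_rotate (M : Matrix (Fin n) (Fin n) ℝ) (θ : ℝ) (v w : RVec n) :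
    quadForm M (Real.cos θ • v - Real.sin θ • w) + quadForm M (Real.sin θ • v + Real.cos θ • w)
      = quadForm M v + quadForm M w := by
  rw [sub_eq_add_neg, ← neg_smul, quadForm_lin_comb, quadForm_lin_comb]
  linear_combination (quadForm M v + quadForm M w) * Real.sin_sq_add_cos_sq θ

theorem quadForm_segment (M : Matrix (Fin n) (Fin n) ℝ) (l : ℝ) (v w c : RVec n) :
    quadForm M (v + l • (w - v) - c) = (1 - l) * quadForm M (v - c) + l * quadForm M (w - c)
      - l * (1 - l) * quadForm M (w - v) := by
  have h₁ : v + l • (w - v) - c = (1 - l) • (v - c) + l • (w - c) := by module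
  have h₂ : w - v = (1 : ℝ) • (w - c) + (-1 : ℝ) • (v - c) := by module
  rw [h₁, h₂, quadForm_lin_comb, quadForm_lin_comb]
  ring

variable {Te Th : Matrix (Fin nx) (Fin nx) ℝ} {Se Sh : Matrix (Fin nu) (Fin nu) ℝ}

theorem Vh_segment (l : ℝ) (r p q : HParams nx nu) :
    Vh Te Th Se Sh r (p + l • (q - p)) = (1 - l) * Vh Te Th Se Sh r p + l * Vh Te Th Se Sh r q
      - l * (1 - l) * Vh Te Th Se Sh p q := by
  simp only [Vh, Prod.fst_add, Prod.snd_add, Prod.smul_fst, Prod.smul_snd, Prod.fst_sub,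
    Prod.snd_sub, quadForm_segment]
  ring

theorem Vh_nonneg (hTe : Te.PosDef) (hTh : Th.PosDef) (hSe : Se.PosDef) (hSh : Sh.PosDef)
    (r p : HParams nx nu) : 0 ≤ Vh Te Th Se Sh r p := by
  simp only [Vh]
  have := @quadForm_nonneg
  have h := this hTe (p.1.1 - r.1.1)
  have h := this hTh (p.1.2.1 - r.1.2.1)
  have h := this hTh (p.1.2.2 - r.1.2.2)
  have h := this hSe (p.2.1 - r.2.1)
  have h := this hSh (p.2.2.1 - r.2.2.1)
  have h := this hSh (p.2.2.2 - r.2.2.2)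
  linarith

theorem exists_mul_norm_sq_le_Vh (hTe : Te.PosDef) (hTh : Th.PosDef) (hSe : Se.PosDef)
    (hSh : Sh.PosDef) :
    ∃ μ > 0, ∀ p q : HParams nx nu, μ * ‖q - p‖ ^ 2 ≤ Vh Te Th Se Sh p q := by
  obtain ⟨μ, hμ, h⟩ := exists_mul_norm_sq_le (f := Vh Te Th Se Sh (0 : HParams nx nu))
    (by unfold Vh quadForm; fun_prop)
    (fun c v => by
      simp only [Vh, Prod.fst_zero, Prod.snd_zero, sub_zero, Prod.smul_fst, Prod.smul_snd,
        quadForm_smul]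
      ring)
    (fun v hv => by
      refine lt_of_le_of_ne (Vh_nonneg hTe hTh hSe hSh _ _) fun h0 => hv ?_
      simp only [Vh, Prod.fst_zero, Prod.snd_zero, sub_zero] at h0
      have h1 := quadForm_nonneg hTe v.1.1
      have h2 := quadForm_nonneg hTh v.1.2.1
      have h3 := quadForm_nonneg hTh v.1.2.2
      have h4 := quadForm_nonneg hSe v.2.1
      have h5 := quadForm_nonneg hSh v.2.2.1
      have h6 := quadForm_nonneg hSh v.2.2.2
      have zero : ∀ {m : ℕ} {M : Matrix (Fin m) (Fin m) ℝ} (_ : M.PosDef) {z : RVec m},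
          quadForm M z ≤ 0 → z = 0 := fun hM z hz => by
        by_contra hne
        exact absurd (quadForm_pos hM hne) hz.not_gt
      have e1 := zero hTe (z := v.1.1) (by linarith)
      have e2 := zero hTh (z := v.1.2.1) (by linarith)
      have e3 := zero hTh (z := v.1.2.2) (by linarith)
      have e4 := zero hSe (z := v.2.1) (by linarith)
      have e5 := zero hSh (z := v.2.2.1) (by linarith)
      have e6 := zero hSh (z := v.2.2.2) (by linarith)
      exact Prod.ext (Prod.ext e1 (Prod.ext e2 e3)) (Prod.ext e4 (Prod.ext e5 e6)))
  refine ⟨μ, hμ, fun p q => (h (q - p)).trans_eq ?_⟩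
  simp [Vh]

end QuadForm

section Harmonic

variable {m nx nu ny : ℕ}

theorem hatT_hatT (θ φ : ℝ) (v : HTriple m) : hatT θ (hatT φ v) = hatT (θ + φ) v := by
  simp only [hatT, Real.cos_add, Real.sin_add]
  refine Prod.ext rfl (Prod.ext ?_ ?_) <;> dsimp only <;> module

theorem hatT_zero (v : HTriple m) : hatT 0 v = v := by
  simp [hatT]

theorem iterate_hatT (w : ℝ) (t : ℕ) (v : HTriple m) : (hatT w)^[t] v = hatT (w * t) v := by
  induction t with
  | zero => simp [hatT_zero]
  | succ t ih =>
    rw [Function.iterate_succ_apply', ih, hatT_hatT]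
    push_cast
    ring_nf

theorem hSeq_hatT (w : ℝ) (t k : ℕ) (v : HTriple m) :
    hSeq w (hatT (w * t) v) k = hSeq w v (k + t) := by
  simp only [hSeq, hatT]
  push_cast
  rw [mul_add, Real.cos_add, Real.sin_add]
  module

theorem hSeq_segment (w l : ℝ) (v v' : HTriple m) (k : ℕ) :
    hSeq w (v + l • (v' - v)) k = hSeq w v k + l • hSeq w (v' - v) k := by
  simp only [hSeq, Prod.fst_add, Prod.snd_add, Prod.smul_fst, Prod.smul_snd]
  module

theorem hSeq_sub (w : ℝ) (v v' : HTriple m) (k : ℕ) :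
    hSeq w (v - v') k = hSeq w v k - hSeq w v' k := by
  simp only [hSeq, Prod.fst_sub, Prod.snd_sub]
  module

theorem norm_hSeq_zero_le (w : ℝ) (v : HTriple m) : ‖hSeq w v 0‖ ≤ 2 * ‖v‖ := by
  have h : hSeq w v 0 = v.1 + v.2.2 := by simp [hSeq]
  have h1 := norm_fst_le v
  have h2 := (norm_snd_le v.2).trans (norm_snd_le v)
  rw [h]
  linarith [norm_add_le v.1 v.2.2]

/-- The phase shift by `θ` of a pair of harmonic parameters. -/
noncomputable def phaseShift (θ : ℝ) (p : HParams nx nu) : HParams nx nu :=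
  (hatT θ p.1, hatT θ p.2)

theorem phaseShift_neg_cancel (θ : ℝ) (p : HParams nx nu) :
    phaseShift θ (phaseShift (-θ) p) = p := by
  simp [phaseShift, hatT_hatT, hatT_zero]

theorem Vh_phaseShift (Te Th : Matrix (Fin nx) (Fin nx) ℝ) (Se Sh : Matrix (Fin nu) (Fin nu) ℝ)
    (θ : ℝ) (r p : HParams nx nu) :
    Vh Te Th Se Sh (phaseShift θ r) (phaseShift θ p) = Vh Te Th Se Sh r p := by
  have key : ∀ {n : ℕ} (M : Matrix (Fin n) (Fin n) ℝ) (a b a' b' : RVec n),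
      quadForm M (Real.cos θ • a - Real.sin θ • b - (Real.cos θ • a' - Real.sin θ • b'))
        + quadForm M (Real.sin θ • a + Real.cos θ • b - (Real.sin θ • a' + Real.cos θ • b'))
      = quadForm M (a - a') + quadForm M (b - b') := fun M a b a' b' => by
    rw [← quadForm_rotate M θ (a - a') (b - b')]
    congr 2 <;> module
  simp only [Vh, phaseShift, hatT]
  linear_combination key Th p.1.2.1 p.1.2.2 r.1.2.1 r.1.2.2
    + key Sh p.2.2.1 p.2.2.2 r.2.2.1 r.2.2.2

variable {A : Matrix (Fin nx) (Fin nx) ℝ} {B : Matrix (Fin nx) (Fin nu) ℝ}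
  {E : Matrix (Fin ny) (Fin nx) ℝ} {F : Matrix (Fin ny) (Fin nu) ℝ} {ylo yhi : RVec ny}
  {w σ : ℝ} {p q : HParams nx nu}

theorem inD.phaseShift (h : inD A B w p) (θ : ℝ) : inD A B w (phaseShift θ p) := by
  obtain ⟨h1, h2, h3⟩ := h
  refine ⟨h1, ?_, ?_⟩ <;> simp only [_root_.phaseShift, hatT, mulVec_add, mulVec_sub, mulVec_smul]
  · linear_combination (norm := module) Real.cos θ • h2 - Real.sin θ • h3
  · linear_combination (norm := module) Real.sin θ • h2 + Real.cos θ • h3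

theorem inD.segment (hp : inD A B w p) (hq : inD A B w q) (l : ℝ) :
    inD A B w (p + l • (q - p)) := by
  obtain ⟨h1, h2, h3⟩ := hp
  obtain ⟨k1, k2, k3⟩ := hq
  refine ⟨?_, ?_, ?_⟩ <;>
    simp only [Prod.fst_add, Prod.snd_add, Prod.smul_fst, Prod.smul_snd, Prod.fst_sub,
      Prod.snd_sub, mulVec_add, mulVec_sub, mulVec_smul]
  · linear_combination (norm := module) (1 - l) • h1 + l • k1
  · linear_combination (norm := module) (1 - l) • h2 + l • k2
  · linear_combination (norm := module) (1 - l) • h3 + l • k3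

theorem inD.hSeq_succ (h : inD A B w p) (k : ℕ) :
    hSeq w p.1 (k + 1) = A.mulVec (hSeq w p.1 k) + B.mulVec (hSeq w p.2 k) := by
  obtain ⟨h1, h2, h3⟩ := h
  simp only [hSeq, mulVec_add, mulVec_smul]
  push_cast
  rw [mul_add, mul_one, Real.cos_add, Real.sin_add]
  linear_combination (norm := module) h1 + Real.sin (w * k) • h2 + Real.cos (w * k) • h3

/-- The dual description of the second-order cone in the plane. -/
theorem sqrt_sq_add_sq_le_iff {a b c : ℝ} :
    √(a ^ 2 + b ^ 2) ≤ c ↔ ∀ α β : ℝ, α ^ 2 + β ^ 2 ≤ 1 → a * α + b * β ≤ c := by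
  set s := √(a ^ 2 + b ^ 2) with hs
  have hs2 : s ^ 2 = a ^ 2 + b ^ 2 := Real.sq_sqrt (by positivity)
  have hs0 : 0 ≤ s := Real.sqrt_nonneg _
  constructor
  · intro h α β hαβ
    refine le_trans (abs_le_of_sq_le_sq' ?_ hs0).2 h
    nlinarith [sq_nonneg (a * β - b * α), sq_nonneg s]
  · intro h
    rcases hs0.eq_or_lt with h0 | hpos
    · simpa [← h0] using h 0 0 (by norm_num)
    · have h' := h (a / s) (b / s) (by
        rw [div_pow, div_pow, ← add_div, ← hs2, div_self (by positivity)])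
      have : a * (a / s) + b * (b / s) = s := by
        field_simp
        linarith
      linarith

theorem inC_iff : inC E F ylo yhi σ p ↔ ∀ i, ∀ α β : ℝ, α ^ 2 + β ^ 2 ≤ 1 →
    |(E.mulVec p.1.2.1 + F.mulVec p.2.2.1) i * α + (E.mulVec p.1.2.2 + F.mulVec p.2.2.2) i * β|
      ≤ min (yhi i - σ - (E.mulVec p.1.1 + F.mulVec p.2.1) i)
        ((E.mulVec p.1.1 + F.mulVec p.2.1) i - ylo i - σ) := by
  simp only [inC, sqrt_sq_add_sq_le_iff]
  refine forall_congr' fun i => ⟨fun h α β hαβ => ?_, fun h => ?_⟩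
  · have h1 := h.1 α β hαβ
    have h2 := h.2 α β hαβ
    have h3 := h.1 (-α) (-β) (by simpa using hαβ)
    have h4 := h.2 (-α) (-β) (by simpa using hαβ)
    rw [abs_le]
    constructor
    · rw [neg_le, le_min_iff]
      constructor <;> linarith
    · rw [le_min_iff]
      constructor <;> linarith
  · exact ⟨fun α β hαβ => (le_abs_self _).trans ((h α β hαβ).trans (min_le_left _ _)),
      fun α β hαβ => (le_abs_self _).trans ((h α β hαβ).trans (min_le_right _ _))⟩

theorem inC.phaseShift (h : inC E F ylo yhi σ p) (θ : ℝ) :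
    inC E F ylo yhi σ (phaseShift θ p) := by
  rw [inC_iff] at h ⊢
  intro i α β hαβ
  have := h i (Real.cos θ * α + Real.sin θ * β) (Real.cos θ * β - Real.sin θ * α) (by
    linear_combination hαβ + (α ^ 2 + β ^ 2) * Real.sin_sq_add_cos_sq θ)
  convert this using 2
  · simp only [_root_.phaseShift, hatT, mulVec_add, mulVec_sub, mulVec_smul, Pi.add_apply,
      Pi.sub_apply, Pi.smul_apply, smul_eq_mul]
    ring
  · rfl
  · rfl

theorem inC.segment (hp : inC E F ylo yhi σ p) (hq : inC E F ylo yhi σ q) {l : ℝ} (h0 : 0 ≤ l)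
    (h1 : l ≤ 1) : inC E F ylo yhi σ (p + l • (q - p)) := by
  simp only [inC, sqrt_sq_add_sq_le_iff] at hp hq ⊢
  intro i
  simp only [Prod.fst_add, Prod.snd_add, Prod.smul_fst, Prod.smul_snd, Prod.fst_sub,
      Prod.snd_sub, mulVec_add, mulVec_sub, mulVec_smul, Pi.add_apply,
    Pi.sub_apply, Pi.smul_apply, smul_eq_mul] at hp hq ⊢
  have h1' : 0 ≤ 1 - l := sub_nonneg.2 h1
  constructor <;> intro α β hαβ
  · linear_combination (1 - l) * (hp i).1 α β hαβ + l * (hq i).1 α β hαβ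
  · linear_combination (1 - l) * (hp i).2 α β hαβ + l * (hq i).2 α β hαβ

theorem inC.output_mem (h : inC E F ylo yhi σ p) (k : ℕ) (i : Fin ny) :
    ylo i + σ ≤ (E.mulVec (hSeq w p.1 k) + F.mulVec (hSeq w p.2 k)) i ∧
      (E.mulVec (hSeq w p.1 k) + F.mulVec (hSeq w p.2 k)) i ≤ yhi i - σ := by
  rw [inC_iff] at h
  have h' := h i (Real.sin (w * k)) (Real.cos (w * k)) (Real.sin_sq_add_cos_sq _).le
  rw [le_min_iff, abs_le, abs_le] at h'
  simp only [hSeq, mulVec_add, mulVec_smul, Pi.add_apply, Pi.smul_apply, smul_eq_mul] at h' ⊢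
  constructor <;> linarith

theorem phaseShift_mem_paramSet (h : p ∈ paramSet A B E F ylo yhi w σ) (θ : ℝ) :
    phaseShift θ p ∈ paramSet A B E F ylo yhi w σ :=
  ⟨h.1.phaseShift θ, h.2.phaseShift θ⟩

theorem segment_mem_paramSet (hp : p ∈ paramSet A B E F ylo yhi w σ)
    (hq : q ∈ paramSet A B E F ylo yhi w σ) {l : ℝ} (h0 : 0 ≤ l) (h1 : l ≤ 1) :
    p + l • (q - p) ∈ paramSet A B E F ylo yhi w σ :=
  ⟨hp.1.segment hq.1 l, hp.2.segment hq.2 h0 h1⟩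

/-- Quadratic growth of the offset cost around a minimizer over `D ∩ C_σ`. -/
theorem Vh_growth {Te Th : Matrix (Fin nx) (Fin nx) ℝ} {Se Sh : Matrix (Fin nu) (Fin nu) ℝ}
    {r : HParams nx nu} (hq : q ∈ paramSet A B E F ylo yhi w σ)
    (hmin : ∀ q' ∈ paramSet A B E F ylo yhi w σ, Vh Te Th Se Sh r q ≤ Vh Te Th Se Sh r q')
    (hp : p ∈ paramSet A B E F ylo yhi w σ) :
    Vh Te Th Se Sh p q / 2 ≤ Vh Te Th Se Sh r p - Vh Te Th Se Sh r q := by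
  have h := hmin _ (segment_mem_paramSet hp hq (l := 1 / 2) (by norm_num) (by norm_num))
  rw [Vh_segment] at h
  linarith

end Harmonic

section Deadbeat

variable {nx nu ny : ℕ}

/-- The state after `k` steps, as a function of the initial state, under time-varying linear
feedback from the initial state. -/
noncomputable def feedbackState (A : Matrix (Fin nx) (Fin nx) ℝ) (B : Matrix (Fin nx) (Fin nu) ℝ)
    (U : ℕ → RVec nx →ₗ[ℝ] RVec nu) : ℕ → RVec nx →ₗ[ℝ] RVec nx
  | 0 => LinearMap.id
  | k + 1 => A.mulVecLin ∘ₗ feedbackState A B U k + B.mulVecLin ∘ₗ U k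

theorem feedbackState_eq_sum (A : Matrix (Fin nx) (Fin nx) ℝ) (B : Matrix (Fin nx) (Fin nu) ℝ)
    (U : ℕ → RVec nx →ₗ[ℝ] RVec nu) (k : ℕ) (z : RVec nx) :
    feedbackState A B U k z = (A ^ k).mulVec z
      + ∑ j ∈ Finset.range k, (A ^ j * B).mulVec (U (k - 1 - j) z) := by
  induction k with
  | zero => simp [feedbackState]
  | succ k ih =>
    rw [Finset.sum_range_succ']
    simp only [feedbackState, LinearMap.add_apply, LinearMap.comp_apply, mulVecLin_apply, ih,
      mulVec_add, mulVec_sum, mulVec_mulVec, ← Matrix.mul_assoc, ← pow_succ']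
    rw [pow_zero, Matrix.one_mul, add_assoc]
    congr 2
    refine Finset.sum_congr rfl fun j _ => ?_
    congr 3
    omega

theorem exists_sum_mulVec_eq {A : Matrix (Fin nx) (Fin nx) ℝ} {B : Matrix (Fin nx) (Fin nu) ℝ}
    {ν N : ℕ} (hν : ν ≤ N) (hrank : (ctrbMat A B ν).rank = nx) (y : RVec nx) :
    ∃ c : ℕ → RVec nu, ∑ j ∈ Finset.range N, (A ^ j * B).mulVec (c j) = y := by
  have hsurj : Function.Surjective (ctrbMat A B ν).mulVecLin := by
    rw [← LinearMap.range_eq_top]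
    apply Submodule.eq_top_of_finrank_eq
    rw [← Matrix.rank, hrank, Module.finrank_fin_fun]
  obtain ⟨g, hg⟩ := hsurj y
  refine ⟨fun j => if h : j < ν then fun i => g (⟨j, h⟩, i) else 0, ?_⟩
  rw [← hg, ← Finset.sum_subset (Finset.range_subset_range.2 hν), Finset.sum_range]
  · ext i
    simp only [Fin.is_lt, dite_true, Finset.sum_apply, mulVec, dotProduct, mulVecLin_apply, ctrbMat,
      Matrix.of_apply, Fintype.sum_prod_type]
  · intro j _ hj
    rw [Finset.mem_range] at hj
    simp [hj]

/-- A controllable system can be steered to the origin in `N` steps by an input sequence depending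
linearly on the initial state. -/
theorem exists_deadbeat {A : Matrix (Fin nx) (Fin nx) ℝ} {B : Matrix (Fin nx) (Fin nu) ℝ}
    {ν N : ℕ} (hν : ν ≤ N) (hrank : (ctrbMat A B ν).rank = nx) :
    ∃ U : ℕ → RVec nx →ₗ[ℝ] RVec nu, ∀ z, feedbackState A B U N z = 0 := by
  let L : (ℕ → RVec nu) →ₗ[ℝ] RVec nx :=
    ∑ j ∈ Finset.range N, (A ^ j * B).mulVecLin ∘ₗ LinearMap.proj j
  have hL : ∀ c, L c = ∑ j ∈ Finset.range N, (A ^ j * B).mulVec (c j) := fun c => by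
    simp [L, LinearMap.sum_apply]
  obtain ⟨G, hG⟩ := L.exists_rightInverse_of_surjective (LinearMap.range_eq_top.2 fun y => by
    simpa only [hL] using exists_sum_mulVec_eq hν hrank y)
  refine ⟨fun k => -(LinearMap.proj (N - 1 - k) ∘ₗ G ∘ₗ (A ^ N).mulVecLin), fun z => ?_⟩
  have h := LinearMap.congr_fun hG ((A ^ N).mulVec z)
  rw [LinearMap.comp_apply, hL, LinearMap.id_apply] at h
  rw [feedbackState_eq_sum]
  nth_rewrite 1 [← h]
  rw [← Finset.sum_add_distrib]
  refine Finset.sum_eq_zero fun j hj => ?_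
  rw [Finset.mem_range] at hj
  have hj' : N - 1 - (N - 1 - j) = j := by omega
  simp [hj', mulVec_neg]

/-- Near an admissible harmonic trajectory, the HMPC problem has a feasible solution with that
trajectory as artificial reference and tracking cost quadratic in the initial distance. -/
theorem exists_feasSol_near {A : Matrix (Fin nx) (Fin nx) ℝ} {B : Matrix (Fin nx) (Fin nu) ℝ}
    (E : Matrix (Fin ny) (Fin nx) ℝ) (F : Matrix (Fin ny) (Fin nu) ℝ) (ylo yhi : RVec ny)
    (w σ : ℝ) (Q Te Th : Matrix (Fin nx) (Fin nx) ℝ) (R Se Sh : Matrix (Fin nu) (Fin nu) ℝ)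
    {ν N : ℕ} (hν : ν ≤ N) (hrank : (ctrbMat A B ν).rank = nx) :
    ∃ c > 0, ∃ C > 0, ∀ (x : RVec nx), ∀ p ∈ paramSet A B E F ylo yhi w σ,
      c * ‖x - hSeq w p.1 0‖ ≤ σ → ∃ xs us, FeasSol A B E F ylo yhi w σ N x xs us p ∧
        ∀ r, Jcost Q Te Th R Se Sh w N r xs us p
          ≤ C * ‖x - hSeq w p.1 0‖ ^ 2 + Vh Te Th Se Sh r p := by
  obtain ⟨U, hU⟩ := exists_deadbeat hν hrank
  set X := feedbackState A B U with hX
  let Y : RVec nx →ₗ[ℝ] Fin N → Fin ny → ℝ :=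
    LinearMap.pi fun k => E.mulVecLin ∘ₗ X k + F.mulVecLin ∘ₗ U k
  obtain ⟨c, hc, hY⟩ := (LinearMap.toContinuousLinearMap Y).bound
  obtain ⟨C, hC, hcost⟩ := exists_le_mul_norm_sq
    (f := fun z => ∑ k ∈ Finset.range N, (quadForm Q (X k z) + quadForm R (U k z)))
    (continuous_finsetSum _ fun k _ =>
      ((continuous_quadForm Q).comp (X k).continuous_of_finiteDimensional).add
        ((continuous_quadForm R).comp (U k).continuous_of_finiteDimensional))
    (fun a z => by simp only [map_smul, quadForm_smul, ← mul_add, Finset.mul_sum])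
  refine ⟨c, hc, C, hC, fun x p hp hx => ?_⟩
  set z := x - hSeq w p.1 0 with hz
  refine ⟨fun k => hSeq w p.1 k + X k z, fun k => hSeq w p.2 k + U k z,
    ⟨?_, fun k _ => ?_, fun k hk i => ?_, ?_, hp.1, hp.2⟩, fun r => ?_⟩
  · simp [hX, feedbackState, hz]
  · simp only [hp.1.hSeq_succ k, hX, feedbackState, LinearMap.add_apply, LinearMap.comp_apply,
      mulVecLin_apply, mulVec_add]
    abel
  · have h1 : |Y z ⟨k, hk⟩ i| ≤ σ :=
      ((norm_le_pi_norm _ i).trans (norm_le_pi_norm (Y z) ⟨k, hk⟩)).trans ((hY z).trans hx)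
    have h2 := hp.2.output_mem (w := w) k i
    simp only [Y, LinearMap.pi_apply, LinearMap.add_apply, LinearMap.comp_apply, mulVecLin_apply,
      abs_le, Pi.add_apply] at h1
    simp only [mulVec_add, Pi.add_apply] at h2 ⊢
    constructor <;> linarith
  · simp [hU]
  · simpa [Jcost] using hcost z

end Deadbeat

section ClosedLoop

variable {nx nu ny : ℕ} {A : Matrix (Fin nx) (Fin nx) ℝ} {B : Matrix (Fin nx) (Fin nu) ℝ}
  {E : Matrix (Fin ny) (Fin nx) ℝ} {F : Matrix (Fin ny) (Fin nu) ℝ} {ylo yhi : RVec ny}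
  {w σ : ℝ} {N : ℕ} {Q Te Th : Matrix (Fin nx) (Fin nx) ℝ} {R Se Sh : Matrix (Fin nu) (Fin nu) ℝ}
  {r p : HParams nx nu} {x : RVec nx} {xs : ℕ → RVec nx} {us : ℕ → RVec nu}

theorem quadForm_add_Vh_le_Jcost (hQ : Q.PosDef) (hR : R.PosDef) (hN : 1 ≤ N) :
    quadForm Q (xs 0 - hSeq w p.1 0) + Vh Te Th Se Sh r p
      ≤ Jcost Q Te Th R Se Sh w N r xs us p := by
  have h := Finset.single_le_sum
    (f := fun k => quadForm Q (xs k - hSeq w p.1 k) + quadForm R (us k - hSeq w p.2 k))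
    (fun k _ => add_nonneg (quadForm_nonneg hQ _) (quadForm_nonneg hR _))
    (Finset.mem_range.2 (show 0 < N by omega))
  have h' := quadForm_nonneg hR (us 0 - hSeq w p.2 0)
  rw [Jcost]
  linarith

/-- Shifting a feasible solution by one step and appending the artificial reference gives a
feasible solution at the successor state, whose cost is smaller by the first stage cost. -/
theorem FeasSol.exists_shift (hσ : 0 ≤ σ) (hR : R.PosDef) (hN : 1 ≤ N)
    (h : FeasSol A B E F ylo yhi w σ N x xs us p) :
    ∃ xs' us', FeasSol A B E F ylo yhi w σ N (A.mulVec x + B.mulVec (us 0)) xs' us'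
        (phaseShift w p) ∧
      Jcost Q Te Th R Se Sh w N (phaseShift w r) xs' us' (phaseShift w p)
          + quadForm Q (x - hSeq w p.1 0)
        ≤ Jcost Q Te Th R Se Sh w N r xs us p := by
  obtain ⟨h0, hdyn, hout, hterm, hD, hC⟩ := h
  have hshift : ∀ {m : ℕ} (v : HTriple m) (k : ℕ), hSeq w (hatT w v) k = hSeq w v (k + 1) :=
    fun v k => by simpa using hSeq_hatT w 1 k v
  have hsucc : ∀ k < N, (if k + 1 ≤ N then xs (k + 1) else hSeq w p.1 (k + 1)) = xs (k + 1) :=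
    fun k hk => if_pos hk
  refine ⟨fun k => if k + 1 ≤ N then xs (k + 1) else hSeq w p.1 (k + 1),
    fun k => if k + 1 < N then us (k + 1) else hSeq w p.2 (k + 1),
    ⟨?_, fun k hk => ?_, fun k hk i => ?_, ?_, hD.phaseShift w, hC.phaseShift w⟩, ?_⟩
  · simp [hN, hdyn 0 hN, h0]
  · dsimp only
    rw [hsucc k hk]
    by_cases hk' : k + 1 < N
    · rw [if_pos (by omega), if_pos hk', hdyn _ hk']
    · rw [if_neg (by omega), if_neg hk', hD.hSeq_succ (k + 1)]
      obtain rfl : N = k + 1 := by omega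
      rw [hterm]
  · dsimp only
    rw [hsucc k hk]
    by_cases hk' : k + 1 < N
    · rw [if_pos hk']
      exact hout _ hk' i
    · rw [if_neg hk']
      obtain rfl : N = k + 1 := by omega
      rw [hterm]
      have := hC.output_mem (w := w) (k + 1) i
      constructor <;> linarith
  · rw [phaseShift, hshift]
    simp
  · obtain ⟨n, rfl⟩ : ∃ n, N = n + 1 := ⟨N - 1, by omega⟩
    rw [Jcost, Jcost, Vh_phaseShift, Finset.sum_range_succ, Finset.sum_range_succ', ← h0]
    simp only [phaseShift, hshift]
    have hsum : ∀ k ∈ Finset.range n,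
        quadForm Q ((if k + 1 ≤ n + 1 then xs (k + 1) else hSeq w p.1 (k + 1)) - hSeq w p.1 (k + 1))
          + quadForm R ((if k + 1 < n + 1 then us (k + 1) else hSeq w p.2 (k + 1))
            - hSeq w p.2 (k + 1))
        = quadForm Q (xs (k + 1) - hSeq w p.1 (k + 1))
          + quadForm R (us (k + 1) - hSeq w p.2 (k + 1)) := fun k hk => by
      rw [Finset.mem_range] at hk
      rw [if_pos (by omega), if_pos (by omega)]
    have hzero : ∀ {m : ℕ} (M : Matrix (Fin m) (Fin m) ℝ), quadForm M 0 = 0 := fun M => by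
      simp [quadForm]
    rw [Finset.sum_congr rfl hsum, if_pos le_rfl, if_neg (lt_irrefl _), hterm, sub_self, sub_self,
      hzero, hzero]
    linarith [quadForm_nonneg hR (us 0 - hSeq w p.2 0)]

end ClosedLoop

section Convergence

/-- Convergence of the distances `e` (state to artificial reference) and `d` (artificial reference
to optimal reference) from the decrease of the cost `J` and the optimality of the artificial
reference. -/
theorem tendsto_zero_of_descent {e d J : ℕ → ℝ} {a c C m σ : ℝ} (ha : 0 < a) (hc : 0 < c)
    (hC : 0 < C) (hm : 0 < m) (hσ : 0 < σ) (he : ∀ t, 0 ≤ e t) (hd : ∀ t, 0 ≤ d t)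
    (hdesc : ∀ t, J (t + 1) + a * e t ^ 2 ≤ J t)
    (hlow : ∀ t, a * e t ^ 2 + m * d t ^ 2 ≤ J t)
    (hopt : ∀ t l, 0 ≤ l → l ≤ 1 → c * (e t + 2 * (l * d t)) ≤ σ →
      l * (m * d t ^ 2) ≤ C * (e t + 2 * (l * d t)) ^ 2) :
    Tendsto (fun t => e t + 2 * d t) atTop (nhds 0) := by
  have hanti : Antitone J := antitone_nat_of_succ_le fun t => by
    have := hdesc t
    have : 0 ≤ a * e t ^ 2 := by positivity
    linarith
  have hJ0 : ∀ t, 0 ≤ J t := fun t => le_trans (by positivity) (hlow t)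
  have hlim : Tendsto J atTop (nhds (⨅ t, J t)) :=
    tendsto_atTop_ciInf hanti ⟨0, Set.forall_mem_range.2 hJ0⟩
  have hdiff : Tendsto (fun t => (J t - J (t + 1)) / a) atTop (nhds 0) := by
    simpa using (hlim.sub (hlim.comp (tendsto_add_atTop_nat 1))).div_const a
  have he2 : Tendsto (fun t => e t ^ 2) atTop (nhds 0) :=
    squeeze_zero (fun t => sq_nonneg _) (fun t => by
      rw [le_div_iff₀ ha]
      linarith [hdesc t]) hdiff
  have sqrt_lim : ∀ {f : ℕ → ℝ}, (∀ t, 0 ≤ f t) → Tendsto (fun t => f t ^ 2) atTop (nhds 0) →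
      Tendsto f atTop (nhds 0) := fun hf h => by
    simpa [Real.sqrt_sq (hf _)] using h.sqrt
  have he0 := sqrt_lim he he2
  obtain ⟨D, hD, hdD⟩ : ∃ D > 0, ∀ t, d t ≤ D := by
    refine ⟨J 0 / m + 1, by have := hJ0 0; positivity, fun t => ?_⟩
    have h1 : m * d t ^ 2 ≤ J 0 := by
      have := hlow t
      have := hanti (Nat.zero_le t)
      have : 0 ≤ a * e t ^ 2 := by positivity
      linarith
    have h2 : d t ^ 2 ≤ J 0 / m := by
      rw [le_div_iff₀ hm]
      linarith
    nlinarith [hd t]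
  obtain ⟨l, hl, hl1, hlσ, hlC⟩ : ∃ l : ℝ, 0 < l ∧ l ≤ 1 ∧ 4 * c * D * l ≤ σ ∧ 16 * C * l ≤ m := by
    refine ⟨min 1 (min (σ / (4 * c * D)) (m / (16 * C))), by positivity, min_le_left _ _, ?_, ?_⟩
    · rw [← le_div_iff₀' (by positivity)]
      exact (min_le_right _ _).trans (min_le_left _ _)
    · rw [← le_div_iff₀' (by positivity)]
      exact (min_le_right _ _).trans (min_le_right _ _)
  have hd2 : Tendsto (fun t => d t ^ 2) atTop (nhds 0) := by
    refine squeeze_zero' (g := fun t => 4 * C / (l * m) * e t ^ 2)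
      (Eventually.of_forall fun t => sq_nonneg _) ?_ (by simpa using he2.const_mul _)
    filter_upwards [he0.eventually (ge_mem_nhds (show 0 < σ / (2 * c) by positivity))] with t ht
    rw [le_div_iff₀ (by positivity)] at ht
    have h1 : c * l * d t ≤ c * l * D := by
      gcongr
      exact hdD t
    have h2 := hopt t l hl.le hl1 (by linarith)
    have h3 : C * (e t + 2 * (l * d t)) ^ 2 ≤ 2 * C * e t ^ 2 + 8 * C * l ^ 2 * d t ^ 2 := by
      linear_combination C * sq_nonneg (e t - 2 * (l * d t))
    have h4 : 16 * C * l * (l * d t ^ 2) ≤ m * (l * d t ^ 2) := by gcongr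
    rw [div_mul_eq_mul_div, le_div_iff₀ (by positivity)]
    linarith
  simpa using he0.add ((sqrt_lim hd hd2).const_mul 2)

variable {nx nu ny : ℕ} {A : Matrix (Fin nx) (Fin nx) ℝ} {B : Matrix (Fin nx) (Fin nu) ℝ}
  {E : Matrix (Fin ny) (Fin nx) ℝ} {F : Matrix (Fin ny) (Fin nu) ℝ} {ylo yhi : RVec ny}
  {w σ : ℝ} {N : ℕ} {Q Te Th : Matrix (Fin nx) (Fin nx) ℝ} {R Se Sh : Matrix (Fin nu) (Fin nu) ℝ}

theorem Vh_phaseShift_min {r₀ rmin : HParams nx nu}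
    (hrmin : IsUniqueMinOn (Vh Te Th Se Sh r₀) (paramSet A B E F ylo yhi w σ) rmin) (θ : ℝ) :
    ∀ q ∈ paramSet A B E F ylo yhi w σ, Vh Te Th Se Sh r₀ rmin
      ≤ Vh Te Th Se Sh (phaseShift θ r₀) q := fun q hq => by
  rw [← phaseShift_neg_cancel θ q, Vh_phaseShift]
  rcases eq_or_ne (phaseShift (-θ) q) rmin with h | h
  · rw [h]
  · exact (hrmin.2 _ (phaseShift_mem_paramSet hq _) h).le

/-- The estimates along the closed loop: cost decrease, quadratic lower bound, consequences of the
optimality of the artificial references `p t`, and the initial bound. Here `J t` is the excess of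
the optimal cost over the minimal offset cost. -/
theorem closedLoop_estimates (hσ : 0 ≤ σ) (hN : 1 ≤ N) (hQ : Q.PosDef) (hR : R.PosDef)
    {a c C μ : ℝ} (hC : 0 ≤ C) (hμ0 : 0 ≤ μ)
    (ha : ∀ v, a * ‖v‖ ^ 2 ≤ quadForm Q v)
    (hμ : ∀ p q : HParams nx nu, μ * ‖q - p‖ ^ 2 ≤ Vh Te Th Se Sh p q)
    (hnear : ∀ (x : RVec nx), ∀ p ∈ paramSet A B E F ylo yhi w σ,
      c * ‖x - hSeq w p.1 0‖ ≤ σ → ∃ xs us, FeasSol A B E F ylo yhi w σ N x xs us p ∧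
        ∀ r, Jcost Q Te Th R Se Sh w N r xs us p
          ≤ C * ‖x - hSeq w p.1 0‖ ^ 2 + Vh Te Th Se Sh r p)
    (hc : 0 ≤ c)
    {r : ℕ → HParams nx nu} (hr : ∀ t : ℕ, r t = phaseShift (w * t) (r 0)) {rmin : HParams nx nu}
    (hrmin : IsUniqueMinOn (Vh Te Th Se Sh (r 0)) (paramSet A B E F ylo yhi w σ) rmin)
    {x : ℕ → RVec nx} {u : ℕ → RVec nu}
    (hcl : ∀ t, ∃ xs us p,
      OptSol A B E F ylo yhi Q Te Th R Se Sh w σ N (r t) (x t) xs us p ∧ u t = us 0)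
    (hdyn : ∀ t, x (t + 1) = A.mulVec (x t) + B.mulVec (u t)) :
    ∃ e d J : ℕ → ℝ, (∀ t, 0 ≤ e t) ∧ (∀ t, 0 ≤ d t) ∧
      (∀ t, J (t + 1) + a * e t ^ 2 ≤ J t) ∧
      (∀ t, a * e t ^ 2 + μ / 2 * d t ^ 2 ≤ J t) ∧
      (∀ t l, 0 ≤ l → l ≤ 1 → c * (e t + 2 * (l * d t)) ≤ σ →
        l * (μ / 2 * d t ^ 2) ≤ C * (e t + 2 * (l * d t)) ^ 2) ∧
      (∀ t, ‖x t - hSeq w rmin.1 t‖ ≤ e t + 2 * d t) ∧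
      (c * ‖x 0 - hSeq w rmin.1 0‖ ≤ σ → J 0 ≤ C * ‖x 0 - hSeq w rmin.1 0‖ ^ 2) := by
  choose xs us p hopt hu using hcl
  let q : ℕ → HParams nx nu := fun t => phaseShift (w * t) rmin
  have hqS : ∀ t, q t ∈ paramSet A B E F ylo yhi w σ := fun t =>
    phaseShift_mem_paramSet hrmin.1 _
  have hqV : ∀ t, Vh Te Th Se Sh (r t) (q t) = Vh Te Th Se Sh (r 0) rmin := fun t => by
    rw [hr t]
    exact Vh_phaseShift _ _ _ _ _ _ _
  have hqmin : ∀ t, ∀ q' ∈ paramSet A B E F ylo yhi w σ,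
      Vh Te Th Se Sh (r t) (q t) ≤ Vh Te Th Se Sh (r t) q' := fun t q' hq' => by
    rw [hqV t, hr t]
    exact Vh_phaseShift_min hrmin _ q' hq'
  have hpS : ∀ t, p t ∈ paramSet A B E F ylo yhi w σ := fun t => (hopt t).1.2.2.2.2
  have hgrow : ∀ t, μ / 2 * ‖q t - p t‖ ^ 2
      ≤ Vh Te Th Se Sh (r t) (p t) - Vh Te Th Se Sh (r t) (q t) := fun t =>
    le_trans (by linarith [hμ (p t) (q t)]) (Vh_growth (hqS t) (hqmin t) (hpS t))
  have hcost : ∀ t, quadForm Q (x t - hSeq w (p t).1 0) + Vh Te Th Se Sh (r t) (p t)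
      ≤ Jcost Q Te Th R Se Sh w N (r t) (xs t) (us t) (p t) := fun t => by
    rw [← (hopt t).1.1]
    exact quadForm_add_Vh_le_Jcost hQ hR hN
  refine ⟨fun t => ‖x t - hSeq w (p t).1 0‖, fun t => ‖q t - p t‖,
    fun t => Jcost Q Te Th R Se Sh w N (r t) (xs t) (us t) (p t) - Vh Te Th Se Sh (r 0) rmin,
    fun t => norm_nonneg _, fun t => norm_nonneg _, fun t => ?_, fun t => ?_,
    fun t l hl0 hl1 hσ' => ?_, fun t => ?_, fun h0 => ?_⟩
  · obtain ⟨xs', us', hf, hle⟩ := (hopt t).1.exists_shift (Q := Q) (Te := Te) (Th := Th)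
      (Se := Se) (Sh := Sh) (r := r t) hσ hR hN
    rw [← hu, ← hdyn] at hf
    have hrs : r (t + 1) = phaseShift w (r t) := by
      rw [hr (t + 1), hr t, phaseShift, phaseShift, phaseShift, hatT_hatT, hatT_hatT]
      push_cast
      ring_nf
    rw [← hrs] at hle
    linarith [(hopt (t + 1)).2 _ _ _ hf, ha (x t - hSeq w (p t).1 0)]
  · linarith [hgrow t, hcost t, hqV t, ha (x t - hSeq w (p t).1 0)]
  · have hdist : ‖x t - hSeq w (p t + l • (q t - p t)).1 0‖
        ≤ ‖x t - hSeq w (p t).1 0‖ + 2 * (l * ‖q t - p t‖) := by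
      have h1 : x t - hSeq w (p t + l • (q t - p t)).1 0
          = x t - hSeq w (p t).1 0 - l • hSeq w ((q t).1 - (p t).1) 0 := by
        rw [Prod.fst_add, Prod.smul_fst, Prod.fst_sub, hSeq_segment, sub_add_eq_sub_sub]
      have h2 : ‖hSeq w ((q t).1 - (p t).1) 0‖ ≤ 2 * ‖q t - p t‖ :=
        (norm_hSeq_zero_le w _).trans (by gcongr; exact norm_fst_le (q t - p t))
      rw [h1]
      refine (norm_sub_le _ _).trans ?_
      rw [norm_smul, Real.norm_of_nonneg hl0]
      linarith [mul_le_mul_of_nonneg_left h2 hl0]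
    obtain ⟨xs', us', hf, hle⟩ := hnear (x t) (p t + l • (q t - p t))
      (segment_mem_paramSet (hpS t) (hqS t) hl0 hl1)
      ((mul_le_mul_of_nonneg_left hdist hc).trans hσ')
    have h1 := (hopt t).2 _ _ _ hf
    have h2 := hle (r t)
    rw [Vh_segment] at h2
    have h3 := hcost t
    have h4 := quadForm_nonneg hQ (x t - hSeq w (p t).1 0)
    have h5 : 0 ≤ l * (1 - l) * Vh Te Th Se Sh (p t) (q t) := by
      have := (mul_nonneg hμ0 (sq_nonneg _)).trans (hμ (p t) (q t))
      have := sub_nonneg.2 hl1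
      positivity
    have h6 := mul_le_mul_of_nonneg_left (hgrow t) hl0
    refine le_trans (b := C * ‖x t - hSeq w (p t + l • (q t - p t)).1 0‖ ^ 2) ?_ (by gcongr)
    linarith
  · have h1 : x t - hSeq w rmin.1 t
        = x t - hSeq w (p t).1 0 - hSeq w ((q t).1 - (p t).1) 0 := by
      have h2 : hSeq w (q t).1 0 = hSeq w rmin.1 t := by
        rw [← Nat.zero_add t, ← hSeq_hatT, Nat.zero_add]
        rfl
      rw [hSeq_sub, h2]
      abel
    rw [h1]
    refine (norm_sub_le _ _).trans (add_le_add_right ((norm_hSeq_zero_le w _).trans ?_) _)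
    gcongr
    exact norm_fst_le (q t - p t)
  · obtain ⟨xs', us', hf, hle⟩ := hnear (x 0) rmin hrmin.1 h0
    linarith [(hopt 0).2 _ _ _ hf, hle (r 0)]

end Convergence

/-- asymptotic stability of HMPC: along the closed loop generated by HMPC with
a harmonically-updated reference, the state remains feasible, the constraints are satisfied,
the state converges to the optimal artificial harmonic reference trajectory
`x̊(t) = x̊_e(0) + x̊_s(0) sin(wt) + x̊_c(0) cos(wt)`, and the closed loop is Lyapunov stable
with respect to this trajectory. -/
theorem statement13 {nx nu ny : ℕ}
    (A : Matrix (Fin nx) (Fin nx) ℝ) (B : Matrix (Fin nx) (Fin nu) ℝ)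
    (E : Matrix (Fin ny) (Fin nx) ℝ) (F : Matrix (Fin ny) (Fin nu) ℝ)
    (ylo yhi : RVec ny) (hy : ∀ i, ylo i < yhi i)
    (w σ : ℝ) (hw : 0 < w) (hσ : 0 < σ) (N : ℕ) (hN : 1 ≤ N)
    (Q Te Th : Matrix (Fin nx) (Fin nx) ℝ) (R Se Sh : Matrix (Fin nu) (Fin nu) ℝ)
    (hQ : Q.PosDef) (hR : R.PosDef) (hTe : Te.PosDef) (hSe : Se.PosDef)
    (hTh : Th.PosDef) (hThd : Th.IsDiag) (hSh : Sh.PosDef) (hShd : Sh.IsDiag)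
    (hctrl : (ctrbMat A B nx).rank = nx)
    (hNidx : ∃ ν ≤ N, (ctrbMat A B ν).rank = nx)
    (hne : (paramSet A B E F ylo yhi w σ).Nonempty)
    (r : ℕ → HParams nx nu)
    (hr : ∀ t, r t = ((hatT w)^[t] (r 0).1, (hatT w)^[t] (r 0).2))
    (rmin : HParams nx nu)
    (hrmin : IsUniqueMinOn (Vh Te Th Se Sh (r 0)) (paramSet A B E F ylo yhi w σ) rmin)
    (x : ℕ → RVec nx) (u : ℕ → RVec nu)
    (hx0 : Feasible A B E F ylo yhi w σ N (x 0))
    (hcl : ∀ t, ∃ xs us p,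
      OptSol A B E F ylo yhi Q Te Th R Se Sh w σ N (r t) (x t) xs us p ∧ u t = us 0)
    (hdyn : ∀ t, x (t + 1) = A.mulVec (x t) + B.mulVec (u t)) :
    (∀ t, Feasible A B E F ylo yhi w σ N (x t)) ∧
    (∀ t, ∀ i, ylo i ≤ (E.mulVec (x t) + F.mulVec (u t)) i ∧
        (E.mulVec (x t) + F.mulVec (u t)) i ≤ yhi i) ∧
    Filter.Tendsto (fun t => ‖x t - hSeq w rmin.1 t‖) Filter.atTop (nhds 0) ∧
    (∀ ε > (0 : ℝ), ∃ δ > (0 : ℝ), ∀ (x' : ℕ → RVec nx) (u' : ℕ → RVec nu),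
      Feasible A B E F ylo yhi w σ N (x' 0) →
      (∀ t, ∃ xs us p,
        OptSol A B E F ylo yhi Q Te Th R Se Sh w σ N (r t) (x' t) xs us p ∧ u' t = us 0) →
      (∀ t, x' (t + 1) = A.mulVec (x' t) + B.mulVec (u' t)) →
      ‖x' 0 - hSeq w rmin.1 0‖ ≤ δ → ∀ t, ‖x' t - hSeq w rmin.1 t‖ ≤ ε) := by
  have hr' : ∀ t : ℕ, r t = phaseShift (w * t) (r 0) := fun t => by
    rw [hr t, iterate_hatT, iterate_hatT, phaseShift]
  obtain ⟨ν, hν, hrank⟩ := hNidx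
  obtain ⟨c, hc, C, hC, hnear⟩ :=
    exists_feasSol_near E F ylo yhi w σ Q Te Th R Se Sh hν hrank
  obtain ⟨a, ha, haQ⟩ := exists_mul_norm_sq_le (continuous_quadForm Q) (quadForm_smul Q)
    fun _ => quadForm_pos hQ
  obtain ⟨μ, hμ, hμV⟩ := exists_mul_norm_sq_le_Vh hTe hTh hSe hSh
  have estimates := fun {x' : ℕ → RVec nx} {u' : ℕ → RVec nu} =>
    closedLoop_estimates (x := x') (u := u') hσ.le hN hQ hR hC.le hμ.le haQ hμV hnear hc.le hr'
      hrmin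
  refine ⟨fun t => ?_, fun t => ?_, ?_, fun ε hε => ?_⟩
  · obtain ⟨xs, us, p, h, -⟩ := hcl t
    exact ⟨xs, us, p, h.1⟩
  · obtain ⟨xs, us, p, h, hu⟩ := hcl t
    rw [hu, ← h.1.1]
    exact h.1.2.2.1 0 hN
  · obtain ⟨e, d, J, he, hd, hdesc, hlow, hopt, hdist, -⟩ := estimates hcl hdyn
    exact squeeze_zero (fun _ => norm_nonneg _) hdist
      (tendsto_zero_of_descent ha hc hC (half_pos hμ) hσ he hd hdesc hlow hopt)
  · set m := min a (μ / 2) with hm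
    have hm0 : 0 < m := by positivity
    set K := C / m + 1 with hK
    have hK0 : 0 < K := by positivity
    refine ⟨min (σ / c) (ε / (3 * K)), by positivity, fun x' u' _ hcl' hdyn' hx' t => ?_⟩
    obtain ⟨e, d, J, he, hd, hdesc, hlow, -, hdist, hinit⟩ := estimates hcl' hdyn'
    rw [le_min_iff, le_div_iff₀' hc, le_div_iff₀' (by positivity)] at hx'
    set ρ := ‖x' 0 - hSeq w rmin.1 0‖ with hρ
    have hρ0 : 0 ≤ ρ := norm_nonneg _
    have hanti : Antitone J := antitone_nat_of_succ_le fun s => by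
      have := hdesc s
      have : 0 ≤ a * e s ^ 2 := by positivity
      linarith
    have hJ : J t ≤ C * ρ ^ 2 := (hanti (Nat.zero_le t)).trans (hinit hx'.1)
    have hCK : C ≤ m * K ^ 2 := by
      have h1 : m * K = C + m := by
        rw [hK]
        field_simp
      have h2 : 1 ≤ K := by
        rw [hK]
        linarith [div_pos hC hm0]
      nlinarith
    have bound : ∀ {z k : ℝ}, 0 ≤ z → m ≤ k → k * z ^ 2 ≤ J t → z ≤ ε / 3 := fun {z k} hz hk h => by
      have h1 : m * z ^ 2 ≤ m * (K * ρ) ^ 2 := calc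
        m * z ^ 2 ≤ k * z ^ 2 := by gcongr
        _ ≤ C * ρ ^ 2 := h.trans hJ
        _ ≤ m * K ^ 2 * ρ ^ 2 := by gcongr
        _ = m * (K * ρ) ^ 2 := by ring
      have h2 : z ≤ K * ρ :=
        le_of_sq_le_sq (le_of_mul_le_mul_left h1 hm0) (by positivity)
      linarith
    have hlt := hlow t
    have h1 : 0 ≤ a * e t ^ 2 := by positivity
    have h2 : 0 ≤ μ / 2 * d t ^ 2 := by positivity
    have he' := bound (he t) (min_le_left _ _) (show a * e t ^ 2 ≤ J t by linarith)
    have hd' := bound (hd t) (min_le_right _ _) (show μ / 2 * d t ^ 2 ≤ J t by linarith)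
    linarith [hdist t]
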